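/- arXiv:math/0007005 — 2 statements merged into one kernel-verified Lean document; each statement's English description precedes it below -/
import Mathlib

section
/- Let 1 ≤ i < j ≤ n−1 and q ∈ ℂ*. For every monogressive ij-effective orthocell datum C = (w; t_1,…,t_d) in S_n there exists an ij-normal orthocell datum C' = (w'; t_1,…,t_d) with the same set of transpositions such that e_{C'}^{ij} = e_C^{ij} or e_{C'}^{ij} = −e_C^{ij}. -/
open Equiv Finset
open scoped TensorProduct

noncomputable section

namespace QFlag
/-- The number of inversions of a permutation of `Fin n`
(the length `ℓ(w)` of `w` in the Coxeter group `Sₙ`). -/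
def invCount {n : ℕ} (w : Equiv.Perm (Fin n)) : ℕ :=
  (Finset.univ.filter fun p : Fin n × Fin n => p.1 < p.2 ∧ w p.2 < w p.1).card

/-- The product `s_L = ∏_{k ∈ L} (a_k b_k)` of the transpositions of the datum
selected by `L ⊆ {1, …, d}` (the factors pairwise commute for an orthocell datum). -/
def sL {n d : ℕ} (t : Fin d → Fin n × Fin n) (L : Finset (Fin d)) : Equiv.Perm (Fin n) :=
  ((L.sort (· ≤ ·)).map fun k => Equiv.swap (t k).1 (t k).2).prod

/-- `t` lists the transpositions `(a_k b_k)` of an orthocell datum: `a_k < b_k` and the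
two-element sets `{a_k, b_k}` are pairwise disjoint. -/
def IsOrthocell {n d : ℕ} (t : Fin d → Fin n × Fin n) : Prop :=
  (∀ k, (t k).1 < (t k).2) ∧
  ∀ k k', k ≠ k' →
    ({(t k).1, (t k).2} : Set (Fin n)) ∩ {(t k').1, (t k').2} = ∅

/-- The orthocell datum `(w; t_1, …, t_d)` is monogressive:
`ℓ(s_L w) = ℓ(w) + |L|` for every `L ⊆ {1, …, d}`. -/
def Monogressive {n d : ℕ} (w : Equiv.Perm (Fin n)) (t : Fin d → Fin n × Fin n) : Prop :=
  ∀ L : Finset (Fin d), invCount (sL t L * w) = invCount w + L.card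

/-- The set `w({1, …, i})` (where `{1, …, i}` means the first `i` elements of `Fin n`). -/
def firstSet {n : ℕ} (w : Equiv.Perm (Fin n)) (i : ℕ) : Finset (Fin n) :=
  (Finset.univ.filter fun p : Fin n => (p : ℕ) < i).image w

/-- The orthocell datum `(w; t_1, …, t_d)` is `i`-effective: for every `k` exactly one of
`a_k`, `b_k` belongs to `w({1, …, i})`. -/
def Effective {n d : ℕ} (w : Equiv.Perm (Fin n)) (t : Fin d → Fin n × Fin n) (i : ℕ) : Prop :=
  ∀ k, Xor' ((t k).1 ∈ firstSet w i) ((t k).2 ∈ firstSet w i)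
/-- The orthocell datum `(w; t_1, …, t_d)` (with `t k = (a_k, b_k)`, `a_k < b_k`) is
`ij`-normal: it is an orthocell datum, monogressive, `ij`-effective, `b_1 < ⋯ < b_d`,
`w(i−d+k) = a_k` and `w(j+k) = b_{d+1−k}` for `1 ≤ k ≤ d` (in particular `d ≤ i` and
`j + d ≤ n`), and `w(1) > ⋯ > w(i−d)`, `w(i+1) > ⋯ > w(j)`, `w(j+d+1) > ⋯ > w(n)`
(all positions written `1`-based, i.e. position `p` is the element `p-1` of `Fin n`). -/
def IJNormal {n d : ℕ} (i j : ℕ) (w : Equiv.Perm (Fin n)) (t : Fin d → Fin n × Fin n) :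
    Prop :=
  IsOrthocell t ∧ Monogressive w t ∧ Effective w t i ∧ Effective w t j ∧
  (∀ k k' : Fin d, k < k' → (t k).2 < (t k').2) ∧
  d ≤ i ∧ j + d ≤ n ∧
  (∀ k : Fin d, (w.symm (t k).1 : ℕ) = i - d + k) ∧
  (∀ k : Fin d, (w.symm (t k).2 : ℕ) = j + (d - 1 - (k : ℕ))) ∧
  (∀ p q : Fin n, p < q → (q : ℕ) < i - d → w q < w p) ∧
  (∀ p q : Fin n, i ≤ (p : ℕ) → p < q → (q : ℕ) < j → w q < w p) ∧
  (∀ p q : Fin n, j + d ≤ (p : ℕ) → p < q → w q < w p)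
/-- The vector `e^i_w = e_{w(1)} ∧ ⋯ ∧ e_{w(i)} ∈ Λ^i ℂⁿ`. -/
def eW (n i : ℕ) (w : Equiv.Perm (Fin n)) : ⋀[ℂ]^i (Fin n → ℂ) :=
  ⟨ExteriorAlgebra.ιMulti ℂ i fun k : Fin i =>
      if h : (k : ℕ) < n then Pi.single (w ⟨k, h⟩) (1 : ℂ) else 0,
    ExteriorAlgebra.ιMulti_range ℂ i (Set.mem_range_self _)⟩

/-- The vector
`e_C^{ij} = ∑_{L ⊆ {1,…,d}} q^{|L|} e^i_{s_{L̄} w} ⊗ e^j_{s_L w} ∈ Λ^iℂⁿ ⊗ Λ^jℂⁿ`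
attached to the orthocell datum `C = (w; t_1, …, t_d)`. -/
def eT {n d : ℕ} (q : ℂ) (i j : ℕ) (w : Equiv.Perm (Fin n)) (t : Fin d → Fin n × Fin n) :
    (⋀[ℂ]^i (Fin n → ℂ)) ⊗[ℂ] (⋀[ℂ]^j (Fin n → ℂ)) :=
  ∑ L : Finset (Fin d),
    q ^ L.card • (eW n i (sL t Lᶜ * w) ⊗ₜ[ℂ] eW n j (sL t L * w))

lemma cast_invCount {n : ℕ} (w : Equiv.Perm (Fin n)) :
    (invCount w : ℤ) = ∑ p, ∑ r, if p < r ∧ w r < w p then (1 : ℤ) else 0 := by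
  rw [invCount, Finset.card_filter, ← Finset.univ_product_univ, Finset.sum_product]
  push_cast
  rfl

lemma sum_two {n : ℕ} (P Q : Fin n) (h : P ≠ Q) (f : Fin n → ℤ) :
    ∑ r, f r = f P + f Q + ∑ r ∈ ({P, Q} : Finset (Fin n))ᶜ, f r := by
  rw [← Finset.sum_add_sum_compl ({P, Q} : Finset (Fin n)), Finset.sum_pair h]

lemma invCount_mul_swap {n : ℕ} (u : Equiv.Perm (Fin n)) (P Q : Fin n) (hPQ : P < Q)
    (hu : u P < u Q) :
    (invCount (u * swap P Q) : ℤ) = invCount u + 1 +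
      2 * ((Finset.univ.filter fun r => P < r ∧ r < Q ∧ u P < u r ∧ u r < u Q).card : ℤ) := by
  have hne : P ≠ Q := hPQ.ne
  have h1 : (invCount (u * swap P Q) : ℤ) =
      ∑ p, ∑ r, if swap P Q p < swap P Q r ∧ u r < u p then (1 : ℤ) else 0 := by
    rw [cast_invCount, ← Equiv.sum_comp (swap P Q)]
    refine Finset.sum_congr rfl fun p _ => ?_
    rw [← Equiv.sum_comp (swap P Q)]
    simp
  have h2 : (invCount (u * swap P Q) : ℤ) - invCount u =
      ∑ p, ∑ r, ((if swap P Q p < swap P Q r ∧ u r < u p then (1 : ℤ) else 0) -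
        if p < r ∧ u r < u p then (1 : ℤ) else 0) := by
    rw [h1, cast_invCount]
    simp only [Finset.sum_sub_distrib]
  set g : Fin n → Fin n → ℤ := fun p r =>
    ((if swap P Q p < swap P Q r ∧ u r < u p then (1 : ℤ) else 0) -
        if p < r ∧ u r < u p then (1 : ℤ) else 0) with hg
  have hz : ∀ p ∈ ({P, Q} : Finset (Fin n))ᶜ, ∀ r ∈ ({P, Q} : Finset (Fin n))ᶜ, g p r = 0 := by
    intro p hp r hr
    simp only [Finset.mem_compl, Finset.mem_insert, Finset.mem_singleton, not_or] at hp hr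
    simp only [hg, swap_apply_of_ne_of_ne hp.1 hp.2, swap_apply_of_ne_of_ne hr.1 hr.2, sub_self]
  have h3 : ∑ p, ∑ r, g p r = g P P + g P Q + g Q P + g Q Q +
      ∑ r ∈ ({P, Q} : Finset (Fin n))ᶜ, (g P r + g Q r + g r P + g r Q) := by
    have : ∑ p ∈ ({P, Q} : Finset (Fin n))ᶜ, ∑ r, g p r =
        ∑ p ∈ ({P, Q} : Finset (Fin n))ᶜ, (g p P + g p Q) := by
      refine Finset.sum_congr rfl fun p hp => ?_
      rw [sum_two P Q hne, Finset.sum_eq_zero (hz p hp), add_zero]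
    rw [sum_two P Q hne, this, sum_two P Q hne (g P), sum_two P Q hne (g Q)]
    simp only [Finset.sum_add_distrib]
    ring
  have h4 : ∀ r ∈ ({P, Q} : Finset (Fin n))ᶜ, (g P r + g Q r + g r P + g r Q) =
      2 * if P < r ∧ r < Q ∧ u P < u r ∧ u r < u Q then (1 : ℤ) else 0 := by
    intro p hp
    simp only [Finset.mem_compl, Finset.mem_insert, Finset.mem_singleton, not_or] at hp
    have e1 : u p ≠ u P := fun h => hp.1 (u.injective h)
    have e2 : u p ≠ u Q := fun h => hp.2 (u.injective h)
    simp only [hg, swap_apply_of_ne_of_ne hp.1 hp.2, swap_apply_left, swap_apply_right]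
    obtain ⟨hp1, hp2⟩ := hp
    generalize u P = x at *
    generalize u Q = y at *
    generalize u p = z at *
    clear h3 hz h2 h1 hg g
    rcases lt_or_gt_of_ne hp1 with a1 | a1 <;> rcases lt_or_gt_of_ne hp2 with a2 | a2 <;>
    rcases lt_or_gt_of_ne e1 with a3 | a3 <;> rcases lt_or_gt_of_ne e2 with a4 | a4 <;>
    first
      | (exfalso; exact absurd (a1.trans (hPQ.trans a2)) (lt_irrefl _))
      | (exfalso; exact absurd (a3.trans (hu.trans a4)) (lt_irrefl _))
      | simp [a1, a2, a3, a4, a1.not_gt, a2.not_gt, a3.not_gt, a4.not_gt]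
  have h5 : g P P + g P Q + g Q P + g Q Q = 1 := by
    simp [hg, hPQ, hPQ.not_gt, hu, hu.not_gt]
  have h6 : ((Finset.univ.filter fun r => P < r ∧ r < Q ∧ u P < u r ∧ u r < u Q).card : ℤ) =
      ∑ r ∈ ({P, Q} : Finset (Fin n))ᶜ,
        if P < r ∧ r < Q ∧ u P < u r ∧ u r < u Q then (1 : ℤ) else 0 := by
    rw [Finset.card_filter]
    push_cast
    rw [sum_two P Q hne]
    simp
  rw [h3, h5, Finset.sum_congr rfl h4, ← Finset.mul_sum, ← h6] at h2
  linarith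

lemma swap_mul_eq {n : ℕ} (u : Equiv.Perm (Fin n)) (a b : Fin n) :
    swap a b * u = u * swap (u.symm a) (u.symm b) := by
  have := Equiv.swap_mul_eq_mul_swap u a b
  simpa using this

lemma invCount_swap_mul {n : ℕ} (u : Equiv.Perm (Fin n)) (a b : Fin n) (hab : a < b)
    (hP : u.symm a < u.symm b) :
    (invCount (swap a b * u) : ℤ) = invCount u + 1 +
      2 * ((Finset.univ.filter fun r => u.symm a < r ∧ r < u.symm b ∧ a < u r ∧ u r < b).card
        : ℤ) := by
  rw [swap_mul_eq, invCount_mul_swap u _ _ hP (by simpa using hab)]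
  simp

lemma cover_iff {n : ℕ} (u : Equiv.Perm (Fin n)) (a b : Fin n) (hab : a < b) :
    invCount (swap a b * u) = invCount u + 1 ↔
      u.symm a < u.symm b ∧ ∀ r, u.symm a < r → r < u.symm b → ¬ (a < u r ∧ u r < b) := by
  rcases lt_trichotomy (u.symm a) (u.symm b) with h | h | h
  · have := invCount_swap_mul u a b hab h
    constructor
    · intro h'
      refine ⟨h, fun r h1 h2 h3 => ?_⟩
      have h0 : (Finset.univ.filter fun r => u.symm a < r ∧ r < u.symm b ∧ a < u r ∧ u r < b).card
        = 0 := by omega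
      rw [Finset.card_eq_zero] at h0
      have : r ∈ (∅ : Finset (Fin n)) := by
        rw [← h0]; simp [h1, h2, h3]
      simp at this
    · rintro ⟨-, h'⟩
      have h0 : (Finset.univ.filter fun r => u.symm a < r ∧ r < u.symm b ∧ a < u r ∧ u r < b).card
        = 0 := by
        rw [Finset.card_eq_zero, Finset.filter_eq_empty_iff]
        rintro r - ⟨h1, h2, h3⟩
        exact h' r h1 h2 h3
      omega
  · exact absurd (u.symm.injective h) hab.ne
  · constructor
    · intro h'
      have e1 : (swap a b * u).symm a = u.symm b := by
        rw [Equiv.symm_apply_eq]; simp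
      have e2 : (swap a b * u).symm b = u.symm a := by
        rw [Equiv.symm_apply_eq]; simp
      have := invCount_swap_mul (swap a b * u) a b hab (by rw [e1, e2]; exact h)
      rw [← mul_assoc, Equiv.swap_mul_self, one_mul] at this
      omega
    · rintro ⟨h', -⟩
      exact absurd h h'.not_gt

lemma IsOrthocell.ne {n d : ℕ} {t : Fin d → Fin n × Fin n} (ht : IsOrthocell t) {k l : Fin d}
    (h : k ≠ l) : (t k).1 ≠ (t l).1 ∧ (t k).1 ≠ (t l).2 ∧ (t k).2 ≠ (t l).1 ∧
      (t k).2 ≠ (t l).2 := by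
  have h0 := ht.2 k l h
  have key : ∀ x, (x = (t k).1 ∨ x = (t k).2) → ¬ (x = (t l).1 ∨ x = (t l).2) := by
    intro x h1 h2
    have : x ∈ (∅ : Set (Fin n)) := by
      rw [← h0]; exact ⟨h1, h2⟩
    exact this
  have k1 := key _ (Or.inl rfl)
  have k2 := key _ (Or.inr rfl)
  tauto

lemma swap_commute {n : ℕ} {a b c e : Fin n} (h : a ≠ c ∧ a ≠ e ∧ b ≠ c ∧ b ≠ e) :
    Commute (swap a b) (swap c e) := by
  obtain ⟨h1, h2, h3, h4⟩ := h
  have := Equiv.swap_mul_eq_mul_swap (swap c e) a b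
  rw [Commute, SemiconjBy, this]
  congr 2
  · simp [swap_apply_of_ne_of_ne h1 h2]
  · simp [swap_apply_of_ne_of_ne h3 h4]

lemma sL_eq {n d : ℕ} {t : Fin d → Fin n × Fin n} (ht : IsOrthocell t) (L : Finset (Fin d))
    (l : List (Fin d)) (hl : l.Nodup) (hL : l.toFinset = L) :
    sL t L = (l.map fun k => Equiv.swap (t k).1 (t k).2).prod := by
  unfold sL
  have hp : List.Perm (L.sort (· ≤ ·)) l := by
    rw [List.perm_ext_iff_of_nodup (Finset.sort_nodup _ _) hl]
    intro a; rw [Finset.mem_sort, ← hL, List.mem_toFinset]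
  refine (hp.map _).prod_eq' ?_
  rw [List.pairwise_map]
  refine (Finset.sort_nodup L (· ≤ ·)).imp ?_
  intro a b hab
  exact swap_commute (ht.ne hab)

lemma sL_empty {n d : ℕ} (t : Fin d → Fin n × Fin n) : sL t ∅ = 1 := by simp [sL]

lemma sL_insert {n d : ℕ} {t : Fin d → Fin n × Fin n} (ht : IsOrthocell t) (L : Finset (Fin d))
    (k : Fin d) (hk : k ∉ L) : sL t (insert k L) = swap (t k).1 (t k).2 * sL t L := by
  rw [sL_eq ht (insert k L) (k :: L.sort (· ≤ ·)) (by simp [hk]) (by simp)]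
  rw [List.map_cons, List.prod_cons, sL]

lemma sL_comp {n d : ℕ} {t : Fin d → Fin n × Fin n} (ht : IsOrthocell t) (L : Finset (Fin d))
    (π : Equiv.Perm (Fin d)) : sL (t ∘ π) L = sL t (L.map π.toEmbedding) := by
  rw [sL_eq ht (L.map π.toEmbedding) ((L.sort (· ≤ ·)).map π)
    ((Finset.sort_nodup _ _).map π.injective) (by
      ext x; simp only [List.mem_toFinset, List.mem_map, Finset.mem_sort, Finset.mem_map,
        Equiv.coe_toEmbedding]), List.map_map]
  rfl

lemma sL_fix {n d : ℕ} {t : Fin d → Fin n × Fin n} (ht : IsOrthocell t) (L : Finset (Fin d))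
    (x : Fin n) (hx : ∀ k ∈ L, x ≠ (t k).1 ∧ x ≠ (t k).2) : sL t L x = x := by
  induction L using Finset.induction_on with
  | empty => simp [sL_empty]
  | insert k L hk ih =>
    rw [sL_insert ht L k hk, Equiv.Perm.mul_apply, ih fun l hl => hx l (by simp [hl])]
    exact swap_apply_of_ne_of_ne (hx k (by simp)).1 (hx k (by simp)).2

lemma sL_pair {n d : ℕ} {t : Fin d → Fin n × Fin n} (ht : IsOrthocell t) (L : Finset (Fin d))
    (k : Fin d) (x : Fin n) (hx : x = (t k).1 ∨ x = (t k).2) :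
    sL t L x = (t k).1 ∨ sL t L x = (t k).2 := by
  induction L using Finset.induction_on with
  | empty => simpa [sL_empty] using hx
  | insert l L hl ih =>
    rw [sL_insert ht L l hl, Equiv.Perm.mul_apply]
    by_cases h : k = l
    · subst h
      rcases ih with h | h <;> simp [h]
    · have := ht.ne h
      rcases ih with h | h
      · left; rw [h]; exact swap_apply_of_ne_of_ne this.1 this.2.1
      · right; rw [h]; exact swap_apply_of_ne_of_ne this.2.2.1 this.2.2.2

lemma IsOrthocell.comp {n d : ℕ} {t : Fin d → Fin n × Fin n} (ht : IsOrthocell t)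
    (π : Equiv.Perm (Fin d)) : IsOrthocell (t ∘ π) :=
  ⟨fun k => ht.1 (π k), fun k l h => ht.2 (π k) (π l) (fun e => h (π.injective e))⟩

lemma Monogressive.comp {n d : ℕ} {t : Fin d → Fin n × Fin n} (ht : IsOrthocell t)
    {w : Equiv.Perm (Fin n)} (h : Monogressive w t)
    (π : Equiv.Perm (Fin d)) : Monogressive w (t ∘ π) := by
  intro L
  rw [sL_comp ht, h, Finset.card_map]

lemma eT_comp {n d : ℕ} {t : Fin d → Fin n × Fin n} (ht : IsOrthocell t)
    (w : Equiv.Perm (Fin n)) (q : ℂ) (i j : ℕ) (π : Equiv.Perm (Fin d)) :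
    eT q i j w (t ∘ π) = eT q i j w t := by
  unfold eT
  refine Fintype.sum_equiv (Equiv.finsetCongr π) _ _ fun L => ?_
  have : (L.map π.toEmbedding)ᶜ = Lᶜ.map π.toEmbedding := by
    ext x; simp
  simp only [sL_comp ht, Equiv.finsetCongr_apply, Finset.card_map, this]

lemma mem_firstSet {n : ℕ} (w : Equiv.Perm (Fin n)) (i : ℕ) (x : Fin n) :
    x ∈ firstSet w i ↔ (w.symm x : ℕ) < i := by
  simp only [firstSet, Finset.mem_image, Finset.mem_filter, Finset.mem_univ, true_and]
  constructor
  · rintro ⟨p, hp, rfl⟩; simpa using hp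
  · intro h; exact ⟨w.symm x, h, by simp⟩

lemma card_firstSet {n : ℕ} (w : Equiv.Perm (Fin n)) (i : ℕ) (hi : i ≤ n) :
    (firstSet w i).card = i := by
  rw [firstSet, Finset.card_image_of_injective _ w.injective, Fin.card_filter_val_lt]
  simp [hi]

lemma eW_mul {n i : ℕ} (hi : i ≤ n) (σ : Equiv.Perm (Fin n))
    (hσ : ∀ p : Fin n, (p : ℕ) < i → (σ p : ℕ) < i) :
    ∃ ε : ℂ, (ε = 1 ∨ ε = -1) ∧ ∀ u, eW n i (u * σ) = ε • eW n i u := by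
  let f : Fin i → Fin i := fun k => ⟨σ ⟨k, k.2.trans_le hi⟩, hσ _ k.2⟩
  have hf : Function.Injective f := by
    intro a b hab
    simp only [f, Fin.mk.injEq, Fin.val_inj] at hab
    have := σ.injective hab
    simpa [Fin.ext_iff] using this
  let τ : Equiv.Perm (Fin i) := Equiv.ofBijective f (Finite.injective_iff_bijective.1 hf)
  have key : ∀ u, eW n i (u * σ) = Equiv.Perm.sign τ • eW n i u := by
    intro u
    apply Subtype.ext
    have := (ExteriorAlgebra.ιMulti ℂ i (M := Fin n → ℂ)).map_perm (fun k : Fin i =>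
      if h : (k : ℕ) < n then Pi.single (u ⟨k, h⟩) (1 : ℂ) else 0) τ
    refine Eq.trans ?_ this
    simp only [eW]
    congr 1
    funext k
    have h1 : (k : ℕ) < n := k.2.trans_le hi
    have h2 : ((τ k : Fin i) : ℕ) < n := (τ k).2.trans_le hi
    simp only [Function.comp, h1, h2, dif_pos]
    rfl
  rcases Int.units_eq_one_or (Equiv.Perm.sign τ) with h | h
  · exact ⟨1, Or.inl rfl, fun u => by rw [key, h, one_smul, one_smul]⟩
  · refine ⟨-1, Or.inr rfl, fun u => ?_⟩
    rw [key, h, Units.neg_smul, one_smul]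
    exact (neg_one_smul ℂ (eW n i u)).symm

lemma eT_mul {n d i j : ℕ} (hi : i ≤ n) (hj : j ≤ n) (σ : Equiv.Perm (Fin n))
    (hσi : ∀ p : Fin n, (p : ℕ) < i → (σ p : ℕ) < i)
    (hσj : ∀ p : Fin n, (p : ℕ) < j → (σ p : ℕ) < j) (q : ℂ) (w : Equiv.Perm (Fin n))
    (t : Fin d → Fin n × Fin n) :
    eT q i j (w * σ) t = eT q i j w t ∨ eT q i j (w * σ) t = -eT q i j w t := by
  obtain ⟨ε, hε, h1⟩ := eW_mul hi σ hσi
  obtain ⟨δ, hδ, h2⟩ := eW_mul hj σ hσj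
  have : eT q i j (w * σ) t = (ε * δ) • eT q i j w t := by
    unfold eT
    rw [Finset.smul_sum]
    refine Finset.sum_congr rfl fun L _ => ?_
    rw [← mul_assoc, ← mul_assoc, h1, h2, TensorProduct.smul_tmul_smul, smul_comm]
  have hn : (-1 : ℂ) • eT q i j w t = -eT q i j w t := neg_one_smul ℂ (eT q i j w t)
  rw [this]
  rcases hε with rfl | rfl <;> rcases hδ with rfl | rfl
  · left; rw [one_mul, one_smul]
  · right; rw [one_mul, hn]
  · right; rw [mul_one, hn]
  · left; rw [neg_mul_neg, one_mul, one_smul]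

lemma mono_cover {n d : ℕ} {t : Fin d → Fin n × Fin n} (ht : IsOrthocell t)
    {w : Equiv.Perm (Fin n)} (h : Monogressive w t) (k : Fin d) (L : Finset (Fin d))
    (hk : k ∉ L) :
    w.symm (t k).1 < w.symm (t k).2 ∧ ∀ r, w.symm (t k).1 < r → r < w.symm (t k).2 →
      ¬ ((t k).1 < sL t L (w r) ∧ sL t L (w r) < (t k).2) := by
  have h1 := h (insert k L)
  rw [sL_insert ht L k hk, mul_assoc, Finset.card_insert_of_notMem hk, ← add_assoc, ← h L,
    cover_iff _ _ _ (ht.1 k)] at h1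
  have ea : (sL t L * w).symm (t k).1 = w.symm (t k).1 := by
    rw [Equiv.symm_apply_eq, Equiv.Perm.mul_apply, Equiv.apply_symm_apply, sL_fix ht]
    intro l hl
    have := ht.ne (k := k) (l := l) (by rintro rfl; exact hk hl)
    exact ⟨this.1, this.2.1⟩
  have eb : (sL t L * w).symm (t k).2 = w.symm (t k).2 := by
    rw [Equiv.symm_apply_eq, Equiv.Perm.mul_apply, Equiv.apply_symm_apply, sL_fix ht]
    intro l hl
    have := ht.ne (k := k) (l := l) (by rintro rfl; exact hk hl)
    exact ⟨this.2.2.1, this.2.2.2⟩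
  rw [ea, eb] at h1
  exact h1

lemma mono_of_cover {n d : ℕ} {t : Fin d → Fin n × Fin n} (ht : IsOrthocell t)
    {w : Equiv.Perm (Fin n)} (h : ∀ (k : Fin d) (L : Finset (Fin d)), k ∉ L →
    w.symm (t k).1 < w.symm (t k).2 ∧ ∀ r, w.symm (t k).1 < r → r < w.symm (t k).2 →
      ¬ ((t k).1 < sL t L (w r) ∧ sL t L (w r) < (t k).2)) : Monogressive w t := by
  intro L
  induction L using Finset.induction_on with
  | empty => simp [sL_empty]
  | insert k L hk ih =>
    rw [sL_insert ht L k hk, mul_assoc, Finset.card_insert_of_notMem hk, ← add_assoc, ← ih,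
      cover_iff _ _ _ (ht.1 k)]
    have ea : (sL t L * w).symm (t k).1 = w.symm (t k).1 := by
      rw [Equiv.symm_apply_eq, Equiv.Perm.mul_apply, Equiv.apply_symm_apply, sL_fix ht]
      intro l hl
      have := ht.ne (k := k) (l := l) (by rintro rfl; exact hk hl)
      exact ⟨this.1, this.2.1⟩
    have eb : (sL t L * w).symm (t k).2 = w.symm (t k).2 := by
      rw [Equiv.symm_apply_eq, Equiv.Perm.mul_apply, Equiv.apply_symm_apply, sL_fix ht]
      intro l hl
      have := ht.ne (k := k) (l := l) (by rintro rfl; exact hk hl)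
      exact ⟨this.2.2.1, this.2.2.2⟩
    rw [ea, eb]
    exact h k L hk

/-- Sorting a finite type of values by an injective key. -/
lemma exists_sorted {n : ℕ} (key : Fin n → ℕ) (hk : Function.Injective key) :
    ∃ v : Equiv.Perm (Fin n), (∀ p r, p < r ↔ key (v p) < key (v r)) ∧
      ∀ S : Finset (Fin n), (∀ x ∈ S, ∀ y, key y < key x → y ∈ S) →
        ∀ x, x ∈ S ↔ (v.symm x : ℕ) < S.card := by
  have hm : StrictMono (key ∘ Tuple.sort key) :=
    (Tuple.monotone_sort key).strictMono_of_injective (hk.comp (Tuple.sort key).injective)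
  have hlt : ∀ p r, p < r ↔ key (Tuple.sort key p) < key (Tuple.sort key r) :=
    fun p r => hm.lt_iff_lt.symm
  refine ⟨Tuple.sort key, hlt, fun S hS x => ?_⟩
  set v := Tuple.sort key
  have hcard : ((Finset.univ.filter fun y => key y < key x).card) = (v.symm x : ℕ) := by
    have : (Finset.univ.filter fun y => key y < key x) = (Finset.Iio (v.symm x)).map v.toEmbedding := by
      ext y
      simp only [Finset.mem_filter, Finset.mem_univ, true_and, Finset.mem_map_equiv,
        Finset.mem_Iio, hlt, Equiv.apply_symm_apply]
    rw [this, Finset.card_map, Fin.card_Iio]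
  rw [← hcard]
  constructor
  · intro hx
    refine Finset.card_lt_card ⟨?_, ?_⟩
    · intro y hy
      simp only [Finset.mem_filter, Finset.mem_univ, true_and] at hy
      exact hS x hx y hy
    · intro h
      have := h hx
      simp at this
  · intro h
    by_contra hx
    refine absurd (Finset.card_le_card ?_) h.not_ge
    intro y hy
    simp only [Finset.mem_filter, Finset.mem_univ, true_and]
    by_contra hxy
    rcases (not_lt.1 hxy).lt_or_eq with h' | h'
    · exact hx (hS y hy x h')
    · exact hx (hk h' ▸ hy)

theorem core {n d : ℕ} (i j : ℕ) (hij : i < j) (hj : j ≤ n)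
    (w : Equiv.Perm (Fin n)) (t : Fin d → Fin n × Fin n)
    (ht : IsOrthocell t) (hmono : Monogressive w t)
    (heffi : Effective w t i) (heffj : Effective w t j)
    (hsort : ∀ k l, k < l → (t k).2 < (t l).2) :
    ∃ w' : Equiv.Perm (Fin n), IJNormal i j w' t ∧
      (∀ x, (w'.symm x : ℕ) < i ↔ (w.symm x : ℕ) < i) ∧
      (∀ x, (w'.symm x : ℕ) < j ↔ (w.symm x : ℕ) < j) := by
  have hsub : ∀ x, x ∈ firstSet w i → x ∈ firstSet w j := by
    intro x; rw [mem_firstSet, mem_firstSet]; omega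
  -- basic position facts
  have hlt : ∀ k, w.symm (t k).1 < w.symm (t k).2 := fun k =>
    (mono_cover ht hmono k ∅ (by simp)).1
  have hA : ∀ k, (t k).1 ∈ firstSet w i := by
    intro k
    rcases heffi k with h | h
    · exact h.1
    · have h1 := h.1
      have := hlt k
      rw [mem_firstSet] at h1 ⊢
      rw [Fin.lt_def] at this
      omega
  have hB : ∀ k, (t k).2 ∉ firstSet w j := by
    intro k
    rcases heffj k with h | h
    · exact h.2
    · exact absurd (hsub _ (hA k)) h.2
  have hmid : ∀ k x, x ∈ firstSet w j → x ∉ firstSet w i → ¬ ((t k).1 < x ∧ x < (t k).2) := by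
    intro k x hxj hxi
    have h0 := (mono_cover ht hmono k ∅ (by simp)).2 (w.symm x)
    have h1 := hA k
    have h2 := hB k
    rw [mem_firstSet] at h1 h2 hxj hxi
    rw [sL_empty, Equiv.Perm.one_apply, Equiv.apply_symm_apply] at h0
    exact h0 (by rw [Fin.lt_def]; omega) (by rw [Fin.lt_def]; omega)
  have hcross : ∀ k l, (t k).1 < (t l).1 → (t l).1 < (t k).2 → (t k).2 < (t l).2 → False := by
    intro k l h1 h2 h3
    have hkl : k ≠ l := by rintro rfl; exact lt_irrefl _ h1
    have a1 := hA k
    have a2 := hB k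
    have a3 := hA l
    have a4 := hB l
    rw [mem_firstSet] at a1 a2 a3 a4
    rcases lt_trichotomy (w.symm (t k).1) (w.symm (t l).1) with h | h | h
    · have h0 := (mono_cover ht hmono k ∅ (by simp)).2 (w.symm (t l).1) h
        (by rw [Fin.lt_def]; omega)
      rw [sL_empty, Equiv.Perm.one_apply, Equiv.apply_symm_apply] at h0
      exact h0 ⟨h1, h2⟩
    · exact h1.ne (w.symm.injective h)
    · have h0 := (mono_cover ht hmono l {k} (by simpa using hkl.symm)).2 (w.symm (t k).1) h
        (by rw [Fin.lt_def]; omega)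
      have : sL t {k} = swap (t k).1 (t k).2 := by simp [sL]
      rw [this, Equiv.apply_symm_apply, swap_apply_left] at h0
      exact h0 ⟨h2, h3⟩
  -- the key
  have ainj : Function.Injective (fun k => (t k).1) := by
    intro k l h
    by_contra hne
    exact (ht.ne hne).1 h
  have binj : Function.Injective (fun k => (t k).2) := by
    intro k l h
    by_contra hne
    exact (ht.ne hne).2.2.2 h
  classical
  let key : Fin n → ℕ := Function.extend (fun k => (t k).1) (fun k => n + ((t k).2 : ℕ))
    (fun x => if x ∈ firstSet w i then n - 1 - (x : ℕ)
      else if x ∈ firstSet w j then 2 * n + (n - 1 - (x : ℕ))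
      else if ∃ k, (t k).2 = x then 3 * n + (n - 1 - (x : ℕ))
      else 4 * n + (n - 1 - (x : ℕ)))
  have keyA : ∀ k, key (t k).1 = n + ((t k).2 : ℕ) := fun k => ainj.extend_apply _ _ k
  have keyN : ∀ x, (¬ ∃ k, (t k).1 = x) → key x = if x ∈ firstSet w i then n - 1 - (x : ℕ)
      else if x ∈ firstSet w j then 2 * n + (n - 1 - (x : ℕ))
      else if ∃ k, (t k).2 = x then 3 * n + (n - 1 - (x : ℕ))
      else 4 * n + (n - 1 - (x : ℕ)) := fun x hx => Function.extend_apply' _ _ x hx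
  have keyBv : ∀ k, key (t k).2 = 3 * n + (n - 1 - ((t k).2 : ℕ)) := by
    intro k
    rw [keyN, if_neg (fun h => hB k (hsub _ h)), if_neg (hB k), if_pos ⟨k, rfl⟩]
    rintro ⟨l, hl⟩
    exact hB k (hl ▸ hsub _ (hA l))
  -- classification of values
  have hcl : ∀ x : Fin n,
      (x ∈ firstSet w i ∧ (¬ ∃ k, (t k).1 = x) ∧ key x = n - 1 - (x : ℕ)) ∨
      (x ∈ firstSet w i ∧ ∃ k, (t k).1 = x ∧ key x = n + ((t k).2 : ℕ)) ∨
      (x ∉ firstSet w i ∧ x ∈ firstSet w j ∧ (¬ ∃ k, (t k).1 = x) ∧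
        key x = 2 * n + (n - 1 - (x : ℕ))) ∨
      (x ∉ firstSet w i ∧ x ∉ firstSet w j ∧ (¬ ∃ k, (t k).1 = x) ∧ (∃ k, (t k).2 = x) ∧
        key x = 3 * n + (n - 1 - (x : ℕ))) ∨
      (x ∉ firstSet w i ∧ x ∉ firstSet w j ∧ (¬ ∃ k, (t k).1 = x) ∧ (¬ ∃ k, (t k).2 = x) ∧
        key x = 4 * n + (n - 1 - (x : ℕ))) := by
    intro x
    by_cases h1 : ∃ k, (t k).1 = x
    · obtain ⟨k, rfl⟩ := h1
      exact Or.inr (Or.inl ⟨hA k, k, rfl, keyA k⟩)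
    · have := keyN x h1
      by_cases h2 : x ∈ firstSet w i
      · rw [if_pos h2] at this; exact Or.inl ⟨h2, h1, this⟩
      · rw [if_neg h2] at this
        by_cases h3 : x ∈ firstSet w j
        · rw [if_pos h3] at this; exact Or.inr (Or.inr (Or.inl ⟨h2, h3, h1, this⟩))
        · rw [if_neg h3] at this
          by_cases h4 : ∃ k, (t k).2 = x
          · rw [if_pos h4] at this
            exact Or.inr (Or.inr (Or.inr (Or.inl ⟨h2, h3, h1, h4, this⟩)))
          · rw [if_neg h4] at this
            exact Or.inr (Or.inr (Or.inr (Or.inr ⟨h2, h3, h1, h4, this⟩)))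
  clear_value key
  have r0 : ∀ x, (x ∈ firstSet w i ∧ ¬ ∃ k, (t k).1 = x) ↔ key x < n := by
    intro x; have hx := x.2
    rcases hcl x with h | ⟨h1, k, h2, h3⟩ | h | h | h
    · simp only [h.1, h.2.1]; simp; omega
    · have : ∃ k, (t k).1 = x := ⟨k, h2⟩
      simp only [this]; simp; omega
    all_goals simp only [h.1]; simp; omega
  have r1 : ∀ x, x ∈ firstSet w i ↔ key x < 2 * n := by
    intro x; have hx := x.2
    rcases hcl x with h | ⟨h1, k, h2, h3⟩ | h | h | h
    · simp only [h.1, true_iff]; omega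
    · have := (t k).2.2
      simp only [h1, true_iff]; omega
    all_goals simp only [h.1, false_iff]; omega
  have r2 : ∀ x, x ∈ firstSet w j ↔ key x < 3 * n := by
    intro x; have hx := x.2
    rcases hcl x with h | ⟨h1, k, h2, h3⟩ | h | h | h
    · simp only [hsub x h.1, true_iff]; omega
    · have := (t k).2.2
      simp only [hsub x h1, true_iff]; omega
    · simp only [h.2.1, true_iff]; omega
    all_goals simp only [h.2.1, false_iff]; omega
  have r3 : ∀ x, (x ∈ firstSet w j ∨ ∃ k, (t k).2 = x) ↔ key x < 4 * n := by
    intro x; have hx := x.2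
    rcases hcl x with h | ⟨h1, k, h2, h3⟩ | h | h | h
    · simp only [hsub x h.1, true_or, true_iff]; omega
    · have := (t k).2.2
      simp only [hsub x h1, true_or, true_iff]; omega
    · simp only [h.2.1, true_or, true_iff]; omega
    · simp only [h.2.2.2.1, or_true, true_iff]; omega
    · simp only [h.2.1, h.2.2.2.1, or_false, false_iff]; omega
  have keyinj : Function.Injective key := by
    intro x y hxy
    have hx := x.2
    have hy := y.2
    rcases hcl x with h | ⟨h1, k, h2, h3⟩ | h | h | h <;>
    rcases hcl y with h' | ⟨h1', k', h2', h3'⟩ | h' | h' | h' <;>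
    first
      | (apply Fin.ext; omega)
      | (exfalso; have := (t k).2.2; omega)
      | (exfalso; have := (t k').2.2; omega)
      | skip
    have : k = k' := binj (Fin.ext (by show ((t k).2 : ℕ) = ((t k').2 : ℕ); omega))
    rw [← h2, ← h2', this]
  obtain ⟨v, hv, hS⟩ := exists_sorted key keyinj
  -- the lower sets
  have hS' : ∀ (S : Finset (Fin n)) (c : ℕ), (∀ x, x ∈ S ↔ key x < c) →
      ∀ x, key x < c ↔ (v.symm x : ℕ) < S.card := by
    intro S c h x
    rw [← h x]
    refine hS S ?_ x
    intro x hx y hy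
    rw [h] at hx ⊢
    omega
  set A : Finset (Fin n) := Finset.univ.image (fun k => (t k).1) with hAdef
  set B : Finset (Fin n) := Finset.univ.image (fun k => (t k).2) with hBdef
  have cA : A.card = d := by rw [hAdef, Finset.card_image_of_injective _ ainj]; simp
  have cB : B.card = d := by rw [hBdef, Finset.card_image_of_injective _ binj]; simp
  have hAi : A ⊆ firstSet w i := by
    intro x hx; simp only [hAdef, Finset.mem_image, Finset.mem_univ, true_and] at hx
    obtain ⟨k, rfl⟩ := hx; exact hA k
  have hBj : Disjoint (firstSet w j) B := by
    rw [Finset.disjoint_left]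
    intro x hx hx'; simp only [hBdef, Finset.mem_image, Finset.mem_univ, true_and] at hx'
    obtain ⟨k, rfl⟩ := hx'; exact hB k hx
  have ci := card_firstSet w i (by omega)
  have cj := card_firstSet w j hj
  have hdi : d ≤ i := by
    have := Finset.card_le_card hAi; omega
  have cJB : (firstSet w j ∪ B).card = j + d := by
    rw [Finset.card_union_of_disjoint hBj, cj, cB]
  have hjd : j + d ≤ n := by
    rw [← cJB]; simpa using Finset.card_le_univ (firstSet w j ∪ B)
  have cIA : (firstSet w i \ A).card = i - d := by
    rw [Finset.card_sdiff_of_subset hAi, ci, cA]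
  have p0 : ∀ x, key x < n ↔ (v.symm x : ℕ) < i - d := by
    rw [← cIA]; refine hS' _ _ fun x => ?_
    rw [← r0]; simp [hAdef]
  have p1 : ∀ x, key x < 2 * n ↔ (v.symm x : ℕ) < i := by
    have := hS' _ _ r1
    rwa [ci] at this
  have p2 : ∀ x, key x < 3 * n ↔ (v.symm x : ℕ) < j := by
    have := hS' _ _ r2
    rwa [cj] at this
  have p3 : ∀ x, key x < 4 * n ↔ (v.symm x : ℕ) < j + d := by
    rw [← cJB]; refine hS' _ _ fun x => ?_
    rw [← r3]; simp [hBdef]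
  have hsle : ∀ k l, k ≤ l ↔ (t k).2 ≤ (t l).2 := by
    have : StrictMono (fun k => (t k).2) := fun k l h => hsort k l h
    intro k l; exact this.le_iff_le.symm
  have hslt : ∀ k l, k < l ↔ (t k).2 < (t l).2 := by
    have : StrictMono (fun k => (t k).2) := fun k l h => hsort k l h
    intro k l; exact this.lt_iff_lt.symm
  have posA : ∀ k : Fin d, (v.symm (t k).1 : ℕ) = i - d + k := by
    intro k
    have e1 : (v.symm (t k).1 : ℕ) < i - d + k + 1 := by
      have hc : (firstSet w i \ A ∪ (Finset.Iic k).image (fun k => (t k).1)).card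
          = i - d + k + 1 := by
        rw [Finset.card_union_of_disjoint, cIA, Finset.card_image_of_injective _ ainj,
          Fin.card_Iic, add_assoc]
        rw [Finset.disjoint_left]
        intro x hx hx'
        simp only [Finset.mem_image] at hx'
        obtain ⟨l, -, rfl⟩ := hx'
        simp [hAdef] at hx
      rw [← hc, ← hS' _ (n + (t k).2 + 1), keyA]
      · omega
      intro x
      simp only [Finset.mem_union, Finset.mem_image, Finset.mem_Iic, Finset.mem_sdiff]
      have : x ∉ A ↔ ¬ ∃ k, (t k).1 = x := by simp [hAdef]
      rw [this, r0]
      constructor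
      · rintro (h | ⟨l, hl, rfl⟩)
        · omega
        · rw [keyA]; rw [hsle, Fin.le_def] at hl; omega
      · intro h
        have := (t k).2.2
        rcases hcl x with h' | ⟨h1, l, h2, h3⟩ | h' | h' | h'
        · left; have := x.2; omega
        · right; refine ⟨l, ?_, h2⟩; rw [hsle, Fin.le_def]; omega
        all_goals omega
    have e2 : ¬ (v.symm (t k).1 : ℕ) < i - d + k := by
      have hc : (firstSet w i \ A ∪ (Finset.Iio k).image (fun k => (t k).1)).card
          = i - d + k := by
        rw [Finset.card_union_of_disjoint, cIA, Finset.card_image_of_injective _ ainj,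
          Fin.card_Iio]
        rw [Finset.disjoint_left]
        intro x hx hx'
        simp only [Finset.mem_image] at hx'
        obtain ⟨l, -, rfl⟩ := hx'
        simp [hAdef] at hx
      rw [← hc, ← hS' _ (n + (t k).2), keyA]
      · omega
      intro x
      simp only [Finset.mem_union, Finset.mem_image, Finset.mem_Iio, Finset.mem_sdiff]
      have : x ∉ A ↔ ¬ ∃ k, (t k).1 = x := by simp [hAdef]
      rw [this, r0]
      constructor
      · rintro (h | ⟨l, hl, rfl⟩)
        · omega
        · rw [keyA]; rw [hslt, Fin.lt_def] at hl; omega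
      · intro h
        have := (t k).2.2
        rcases hcl x with h' | ⟨h1, l, h2, h3⟩ | h' | h' | h'
        · left; have := x.2; omega
        · right; refine ⟨l, ?_, h2⟩; rw [hslt, Fin.lt_def]; omega
        all_goals omega
    omega
  have posB : ∀ k : Fin d, (v.symm (t k).2 : ℕ) = j + (d - 1 - (k : ℕ)) := by
    intro k
    have hkd := k.2
    have e1 : (v.symm (t k).2 : ℕ) < j + (d - k) := by
      have hc : (firstSet w j ∪ (Finset.Ici k).image (fun k => (t k).2)).card
          = j + (d - k) := by
        rw [Finset.card_union_of_disjoint, cj, Finset.card_image_of_injective _ binj,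
          Fin.card_Ici]
        rw [Finset.disjoint_left]
        intro x hx hx'
        simp only [Finset.mem_image] at hx'
        obtain ⟨l, -, rfl⟩ := hx'
        exact hB l hx
      rw [← hc, ← hS' _ (3 * n + (n - 1 - (t k).2) + 1), keyBv]
      · omega
      intro x
      simp only [Finset.mem_union, Finset.mem_image, Finset.mem_Ici]
      rw [r2]
      constructor
      · rintro (h | ⟨l, hl, rfl⟩)
        · omega
        · rw [keyBv]; rw [hsle, Fin.le_def] at hl; omega
      · intro h
        have := (t k).2.2
        by_cases hx3 : key x < 3 * n
        · exact Or.inl hx3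
        · right
          have : ∃ l, (t l).2 = x := by
            have := (r3 x).2 (by omega)
            rw [r2] at this
            exact this.resolve_left hx3
          obtain ⟨l, rfl⟩ := this
          refine ⟨l, ?_, rfl⟩
          rw [keyBv] at h
          have := (t l).2.2
          rw [hsle, Fin.le_def]; omega
    have e2 : ¬ (v.symm (t k).2 : ℕ) < j + (d - 1 - k) := by
      have hc : (firstSet w j ∪ (Finset.Ioi k).image (fun k => (t k).2)).card
          = j + (d - 1 - k) := by
        rw [Finset.card_union_of_disjoint, cj, Finset.card_image_of_injective _ binj,
          Fin.card_Ioi]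
        rw [Finset.disjoint_left]
        intro x hx hx'
        simp only [Finset.mem_image] at hx'
        obtain ⟨l, -, rfl⟩ := hx'
        exact hB l hx
      rw [← hc, ← hS' _ (3 * n + (n - 1 - (t k).2)), keyBv]
      · omega
      intro x
      simp only [Finset.mem_union, Finset.mem_image, Finset.mem_Ioi]
      rw [r2]
      constructor
      · rintro (h | ⟨l, hl, rfl⟩)
        · omega
        · rw [keyBv]; rw [hslt, Fin.lt_def] at hl
          have := (t l).2.2
          omega
      · intro h
        have := (t k).2.2
        by_cases hx3 : key x < 3 * n
        · exact Or.inl hx3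
        · right
          have : ∃ l, (t l).2 = x := by
            have := (r3 x).2 (by omega)
            rw [r2] at this
            exact this.resolve_left hx3
          obtain ⟨l, rfl⟩ := this
          refine ⟨l, ?_, rfl⟩
          rw [keyBv] at h
          have := (t l).2.2
          rw [hslt, Fin.lt_def]; omega
    omega
  have qi : ∀ x, (v.symm x : ℕ) < i ↔ (w.symm x : ℕ) < i := by
    intro x; rw [← p1, ← r1, mem_firstSet]
  have qj : ∀ x, (v.symm x : ℕ) < j ↔ (w.symm x : ℕ) < j := by
    intro x; rw [← p2, ← r2, mem_firstSet]
  refine ⟨v, ⟨ht, ?_, ?_, ?_, hsort, hdi, hjd, posA, posB, ?_, ?_, ?_⟩, qi, qj⟩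
  · refine mono_of_cover ht fun k L hk => ⟨?_, fun r h1 h2 h3 => ?_⟩
    · rw [Fin.lt_def, posA, posB]; have := k.2; omega
    · obtain ⟨x, rfl⟩ : ∃ x, r = v.symm x := ⟨v r, by simp⟩
      rw [hv] at h1 h2
      simp only [Equiv.apply_symm_apply] at h1 h2 h3
      rw [keyA] at h1
      rw [keyBv] at h2
      have hx := x.2
      have hk2 := (t k).2.2
      have main : ∀ l, k < l → (x = (t l).1 ∨ x = (t l).2) → False := by
        intro l hl hxl
        have hb := hsort k l hl
        rcases sL_pair ht L l x hxl with h | h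
        · rw [h] at h3
          exact hcross k l h3.1 h3.2 hb
        · rw [h] at h3
          exact lt_asymm hb h3.2
      rcases hcl x with h | ⟨h4, l, h5, h6⟩ | h | h | h
      · omega
      · refine main l ?_ (Or.inl h5.symm)
        rw [hslt, Fin.lt_def]; omega
      · have : sL t L x = x := sL_fix ht L x fun l _ => ⟨fun e => h.2.2.1 ⟨l, e.symm⟩,
          fun e => hB l (e ▸ h.2.1)⟩
        rw [this] at h3
        exact hmid k x h.2.1 h.1 h3
      · obtain ⟨l, hl⟩ := h.2.2.2.1
        refine main l ?_ (Or.inr hl.symm)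
        rw [hslt, Fin.lt_def, hl]; omega
      · omega
  · intro k
    have := heffi k
    simpa only [mem_firstSet, qi] using this
  · intro k
    have := heffj k
    simpa only [mem_firstSet, qj] using this
  · intro p r hpr hr
    have k1 := (hv p r).1 hpr
    have k2 := (p0 (v r)).2 (by simpa using hr)
    rw [Fin.lt_def]
    have := (v p).2
    have := (v r).2
    rcases hcl (v r) with h | ⟨h4, l, h5, h6⟩ | h | h | h <;>
    rcases hcl (v p) with h' | ⟨h4', l', h5', h6'⟩ | h' | h' | h' <;> omega
  · intro p r hp hpr hr
    have k1 := (hv p r).1 hpr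
    have k2 := (p2 (v r)).2 (by simpa using hr)
    have k3 := (not_congr (p1 (v p))).2 (by simpa using hp)
    rw [Fin.lt_def]
    have := (v p).2
    have := (v r).2
    rcases hcl (v r) with h | ⟨h4, l, h5, h6⟩ | h | h | h <;>
    rcases hcl (v p) with h' | ⟨h4', l', h5', h6'⟩ | h' | h' | h' <;>
    first
      | omega
      | (have := (t l).2.2; omega)
      | (have := (t l').2.2; omega)
  · intro p r hp hpr
    have k1 := (hv p r).1 hpr
    have k3 := (not_congr (p3 (v p))).2 (by simpa using hp)
    rw [Fin.lt_def]
    have := (v p).2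
    have := (v r).2
    rcases hcl (v r) with h | ⟨h4, l, h5, h6⟩ | h | h | h <;>
    rcases hcl (v p) with h' | ⟨h4', l', h5', h6'⟩ | h' | h' | h' <;>
    first
      | omega
      | (have := (t l).2.2; omega)
      | (have := (t l').2.2; omega)

/-- Every monogressive `ij`-effective orthocell datum can be normalized:
there are `w'` and a relisting of the same set of transpositions giving an `ij`-normal
datum `C'` with `e_{C'}^{ij} = ± e_C^{ij}`. -/
theorem exists_ijNormal {n d : ℕ} (i j : ℕ) (hi : 1 ≤ i) (hij : i < j) (hj : j ≤ n - 1)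
    (q : ℂ) (hq : q ≠ 0) (w : Equiv.Perm (Fin n)) (t : Fin d → Fin n × Fin n)
    (ht : IsOrthocell t) (hmono : Monogressive w t)
    (heffi : Effective w t i) (heffj : Effective w t j) :
    ∃ (w' : Equiv.Perm (Fin n)) (π : Equiv.Perm (Fin d)),
      IJNormal i j w' (t ∘ π) ∧
      (eT q i j w' (t ∘ π) = eT q i j w t ∨ eT q i j w' (t ∘ π) = -eT q i j w t) := by
  have binj : Function.Injective (fun k => (t k).2) := by
    intro k l h
    by_contra hne
    exact (ht.ne hne).2.2.2 h
  set π : Equiv.Perm (Fin d) := Tuple.sort (fun k => (t k).2) with hπ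
  have hm : StrictMono ((fun k => (t k).2) ∘ π) :=
    (Tuple.monotone_sort _).strictMono_of_injective (binj.comp π.injective)
  obtain ⟨w', hN, qi, qj⟩ := core i j hij (by omega) w (t ∘ π) (ht.comp π) (hmono.comp ht π)
    (fun k => heffi (π k)) (fun k => heffj (π k)) (fun k l h => hm h)
  refine ⟨w', π, hN, ?_⟩
  have hw : w' = w * (w⁻¹ * w') := by rw [mul_inv_cancel_left]
  rw [eT_comp ht, hw]
  refine eT_mul (by omega) (by omega) _ ?_ ?_ q w t
  · intro p hp
    have := (qi (w' p)).1 (by simpa using hp)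
    exact this
  · intro p hp
    have := (qj (w' p)).1 (by simpa using hp)
    exact this

end QFlag
end
end

section
/- Let 1 ≤ i < j ≤ n−1 and let q ∈ ℂ* not be a root of unity. Then the family of vectors e_C^{ij} ∈ Λ^iℂⁿ ⊗ Λ^jℂⁿ, where C ranges over all ij-normal orthocell data in S_n, is linearly independent. -/
open Equiv Finset
open scoped TensorProduct

noncomputable section

namespace QFlag
lemma list_prod_apply {n d : ℕ} {t : Fin d → Fin n × Fin n} (ht : IsOrthocell t)
    (l : List (Fin d)) (hl : l.Nodup) :
    (∀ k, (l.map fun k => Equiv.swap (t k).1 (t k).2).prod (t k).1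
        = if k ∈ l then (t k).2 else (t k).1) ∧
    (∀ k, (l.map fun k => Equiv.swap (t k).1 (t k).2).prod (t k).2
        = if k ∈ l then (t k).1 else (t k).2) ∧
    (∀ x, (∀ k, x ≠ (t k).1) → (∀ k, x ≠ (t k).2) →
        (l.map fun k => Equiv.swap (t k).1 (t k).2).prod x = x) := by
  have hdis : ∀ k k', k ≠ k' → (t k).1 ≠ (t k').1 ∧ (t k).1 ≠ (t k').2 ∧
      (t k).2 ≠ (t k').1 ∧ (t k).2 ≠ (t k').2 := by
    intro k k' h
    have h2 := ht.2 k k' h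
    rw [Set.eq_empty_iff_forall_notMem] at h2
    have h3 := h2 (t k).1
    have h4 := h2 (t k).2
    simp at h3 h4
    tauto
  induction l with
  | nil => simp
  | cons m l ih =>
    rw [List.nodup_cons] at hl
    obtain ⟨ih1, ih2, ih3⟩ := ih hl.2
    refine ⟨?_, ?_, ?_⟩
    · intro k
      rw [List.map_cons, List.prod_cons, Equiv.Perm.mul_apply, ih1]
      by_cases hkm : k = m
      · subst hkm
        simp [hl.1]
      · obtain ⟨h1, h2, h3, h4⟩ := hdis k m hkm
        by_cases hk : k ∈ l
        · simp [hk, Equiv.swap_apply_of_ne_of_ne h3 h4]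
        · simp [hk, hkm, Equiv.swap_apply_of_ne_of_ne h1 h2]
    · intro k
      rw [List.map_cons, List.prod_cons, Equiv.Perm.mul_apply, ih2]
      by_cases hkm : k = m
      · subst hkm
        simp [hl.1]
      · obtain ⟨h1, h2, h3, h4⟩ := hdis k m hkm
        by_cases hk : k ∈ l
        · simp [hk, Equiv.swap_apply_of_ne_of_ne h1 h2]
        · simp [hk, hkm, Equiv.swap_apply_of_ne_of_ne h3 h4]
    · intro x h1 h2
      rw [List.map_cons, List.prod_cons, Equiv.Perm.mul_apply, ih3 x h1 h2]
      exact Equiv.swap_apply_of_ne_of_ne (h1 m) (h2 m)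

lemma sL_fst {n d : ℕ} {t : Fin d → Fin n × Fin n} (ht : IsOrthocell t)
    (L : Finset (Fin d)) (k : Fin d) :
    sL t L (t k).1 = if k ∈ L then (t k).2 else (t k).1 := by
  have := (list_prod_apply ht (L.sort (· ≤ ·)) (Finset.sort_nodup _ _)).1 k
  simpa [sL] using this

lemma sL_other {n d : ℕ} {t : Fin d → Fin n × Fin n} (ht : IsOrthocell t)
    (L : Finset (Fin d)) (x : Fin n) (h1 : ∀ k, x ≠ (t k).1) (h2 : ∀ k, x ≠ (t k).2) :
    sL t L x = x :=
  (list_prod_apply ht (L.sort (· ≤ ·)) (Finset.sort_nodup _ _)).2.2 x h1 h2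

lemma invCount_gap {n : ℕ} (w : Equiv.Perm (Fin n)) (p r q : Fin n) (hpr : p < r) (hrq : r < q)
    (h1 : w p < w r) (h2 : w r < w q) :
    invCount w + 2 ≤ invCount (Equiv.swap (w p) (w q) * w) := by
  classical
  set u := Equiv.swap (w p) (w q) * w with hu
  set s := Equiv.swap p q with hs
  have hup : u p = w q := by simp [hu]
  have huq : u q = w p := by simp [hu]
  have huo : ∀ x, x ≠ p → x ≠ q → u x = w x := by
    intro x hx hx'
    simp only [hu, Equiv.Perm.mul_apply]
    exact Equiv.swap_apply_of_ne_of_ne (by simpa using hx) (by simpa using hx')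
  have hsp : s p = q := by simp [hs]
  have hsq : s q = p := by simp [hs]
  have hso : ∀ x, x ≠ p → x ≠ q → s x = x := fun x hx hx' =>
    Equiv.swap_apply_of_ne_of_ne hx hx'
  have hss : ∀ x, s (s x) = x := fun x => by simp [hs]
  have hus : ∀ x, u (s x) = w x := by
    intro x
    by_cases hx : x = p
    · subst hx; rw [hsp, huq]
    · by_cases hx' : x = q
      · subst hx'; rw [hsq, hup]
      · rw [hso x hx hx', huo x hx hx']
  let f : Fin n × Fin n → Fin n × Fin n := fun z =>
    if s z.1 < s z.2 then (s z.1, s z.2) else z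
  set A := Finset.univ.filter fun p : Fin n × Fin n => p.1 < p.2 ∧ w p.2 < w p.1 with hA
  set B := Finset.univ.filter fun p : Fin n × Fin n => p.1 < p.2 ∧ u p.2 < u p.1 with hB
  have hinj : Set.InjOn f A := by
    rintro ⟨x, y⟩ hxy ⟨x', y'⟩ hxy' h
    simp only [hA, Finset.coe_filter, Finset.mem_univ, true_and, Set.mem_ofPred_eq] at hxy hxy'
    simp only [f] at h
    split_ifs at h with c1 c2 c2
    · simpa using h
    · simp only [Prod.mk.injEq] at h
      exfalso; apply c2
      rw [← h.1, ← h.2, hss, hss]; exact hxy.1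
    · simp only [Prod.mk.injEq] at h
      exfalso; apply c1
      rw [h.1, h.2, hss, hss]; exact hxy'.1
    · exact h
  have himg : insert (p, q) (insert (p, r) (A.image f)) ⊆ B := by
    intro z hz
    simp only [Finset.mem_insert, Finset.mem_image] at hz
    simp only [hB, Finset.mem_filter, Finset.mem_univ, true_and]
    rcases hz with rfl | rfl | ⟨⟨x, y⟩, hxy, rfl⟩
    · exact ⟨hpr.trans hrq, by rw [hup, huq]; exact h1.trans h2⟩
    · exact ⟨hpr, by rw [hup, huo r hpr.ne' hrq.ne]; exact h2⟩
    · simp only [hA, Finset.mem_filter, Finset.mem_univ, true_and] at hxy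
      simp only [f]
      split_ifs with c
      · exact ⟨c, by simpa only [hus] using hxy.2⟩
      · refine ⟨hxy.1, ?_⟩
        simp only
        by_cases hx : x = p
        · subst hx
          by_cases hy : y = q
          · subst hy
            exact absurd hxy.2 (not_lt.2 (h1.trans h2).le)
          · rw [hup, huo y hxy.1.ne' hy]
            exact hxy.2.trans (h1.trans h2)
        · by_cases hy : y = q
          · subst hy
            rw [huq, huo x hx hxy.1.ne]
            exact (h1.trans h2).trans hxy.2
          · exfalso; apply c
            by_cases hx' : x = q
            · subst hx'
              have : y ≠ p := (hpr.trans hrq |>.trans hxy.1).ne'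
              rw [hsq, hso y this hy]
              exact hpr.trans hrq |>.trans hxy.1
            · by_cases hy' : y = p
              · subst hy'
                rw [hsp, hso x hx hx']
                exact hxy.1.trans (hpr.trans hrq)
              · rw [hso x hx hx', hso y hy' hy]; exact hxy.1
  have hn1 : (p, r) ∉ A.image f := by
    simp only [Finset.mem_image, not_exists, not_and]
    rintro ⟨x, y⟩ hxy h
    simp only [hA, Finset.mem_filter, Finset.mem_univ, true_and] at hxy
    simp only [f] at h
    split_ifs at h with c
    · simp only [Prod.mk.injEq] at h
      have e1 := congrArg s h.1
      have e2 := congrArg s h.2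
      rw [hss, hsp] at e1
      rw [hss, hso r hpr.ne' hrq.ne] at e2
      subst e1 e2
      exact absurd hxy.1 (not_lt.2 hrq.le)
    · simp only [Prod.mk.injEq] at h
      rw [h.1, h.2] at hxy
      exact absurd hxy.2 (not_lt.2 h1.le)
  have hn2 : (p, q) ∉ insert (p, r) (A.image f) := by
    simp only [Finset.mem_insert, Finset.mem_image, not_or, not_exists, not_and]
    refine ⟨by simp [hrq.ne'], ?_⟩
    rintro ⟨x, y⟩ hxy h
    simp only [hA, Finset.mem_filter, Finset.mem_univ, true_and] at hxy
    simp only [f] at h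
    split_ifs at h with c
    · simp only [Prod.mk.injEq] at h
      have e1 := congrArg s h.1
      have e2 := congrArg s h.2
      rw [hss, hsp] at e1
      rw [hss, hsq] at e2
      subst e1 e2
      exact absurd hxy.1 (not_lt.2 (hpr.trans hrq).le)
    · simp only [Prod.mk.injEq] at h
      rw [h.1, h.2] at hxy
      exact absurd hxy.2 (not_lt.2 (h1.trans h2).le)
  have hc := Finset.card_le_card himg
  rw [Finset.card_insert_of_notMem hn2, Finset.card_insert_of_notMem hn1,
    Finset.card_image_of_injOn hinj] at hc
  exact hc

lemma no_between {n d i j : ℕ} {w : Equiv.Perm (Fin n)} {t : Fin d → Fin n × Fin n}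
    (h : IJNormal i j w t) (k : Fin d) (r : Fin n) (h1 : i - d + k < (r : ℕ))
    (h2 : (r : ℕ) < j + (d - 1 - (k : ℕ))) (h3 : (t k).1 < w r) (h4 : w r < (t k).2) : False := by
  obtain ⟨ho, hm, -, -, -, -, -, ha, hb, -⟩ := h
  have h5 := hm {k}
  have h6 := invCount_gap w (w.symm (t k).1) r (w.symm (t k).2)
    (by rw [Fin.lt_def, ha]; exact h1) (by rw [Fin.lt_def, hb]; exact h2)
    (by simpa using h3) (by simpa using h4)
  simp [sL] at h5 h6
  omega

/-- The leading `i`-set. -/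
def topSet {n d : ℕ} (i : ℕ) (w : Equiv.Perm (Fin n)) (t : Fin d → Fin n × Fin n) :
    Finset (Fin n) := firstSet (sL t Finset.univ * w) i

lemma mem_topSet {n d i j : ℕ} (hij : i < j) {w : Equiv.Perm (Fin n)}
    {t : Fin d → Fin n × Fin n}
    (h : IJNormal i j w t) (x : Fin n) :
    x ∈ topSet i w t ↔ (w.symm x : ℕ) < i - d ∨ (j ≤ (w.symm x : ℕ) ∧ (w.symm x : ℕ) < j + d) := by
  obtain ⟨ho, hm, -, -, -, hd, hjd, ha, hb, -⟩ := h
  have hfix : ∀ r : Fin n, (r : ℕ) < i - d → sL t Finset.univ (w r) = w r := by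
    intro r hr
    apply sL_other ho
    · intro k hk
      have := ha k
      rw [← hk] at this
      simp at this
      omega
    · intro k hk
      have := hb k
      rw [← hk] at this
      simp at this
      omega
  constructor
  · intro hx
    simp only [topSet, firstSet, Finset.mem_image, Finset.mem_filter, Finset.mem_univ,
      true_and] at hx
    obtain ⟨r, hr, rfl⟩ := hx
    rw [Equiv.Perm.mul_apply]
    by_cases hr' : (r : ℕ) < i - d
    · left; rw [hfix r hr']; simpa using hr'
    · right
      have hk : (r : ℕ) - (i - d) < d := by omega
      have hwr : w r = (t ⟨r - (i - d), hk⟩).1 := by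
        rw [← Equiv.eq_symm_apply]
        apply Fin.ext
        rw [ha]; simp; omega
      rw [hwr, sL_fst ho]
      simp only [Finset.mem_univ, if_true]
      rw [hb]
      omega
  · rintro (hx | ⟨hx, hx'⟩)
    · simp only [topSet, firstSet, Finset.mem_image, Finset.mem_filter, Finset.mem_univ, true_and]
      refine ⟨w.symm x, by omega, ?_⟩
      rw [Equiv.Perm.mul_apply, hfix _ hx]; simp
    · have hk : d - 1 - ((w.symm x : ℕ) - j) < d := by omega
      set k : Fin d := ⟨_, hk⟩ with hkd
      have hxk : x = (t k).2 := by
        apply w.symm.injective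
        apply Fin.ext
        rw [hb]; simp only [hkd]; omega
      simp only [topSet, firstSet, Finset.mem_image, Finset.mem_filter, Finset.mem_univ, true_and]
      refine ⟨w.symm (t k).1, ?_, ?_⟩
      · rw [ha]; have := k.2; omega
      · rw [Equiv.Perm.mul_apply, Equiv.apply_symm_apply, sL_fst ho]; simp [hxk]

lemma agree {n : ℕ} (w w' : Equiv.Perm (Fin n)) (P : Fin n → Prop)
    (h : ∀ p q, P p → P q → p < q → w q < w p)
    (h' : ∀ p q, P p → P q → p < q → w' q < w' p)
    (hP : ∀ x, P (w.symm x) ↔ P (w'.symm x)) (p : Fin n) : P p → w p = w' p := by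
  induction p using WellFoundedLT.induction with
  | ind p ih =>
    intro hp
    have key : ∀ v v' : Equiv.Perm (Fin n),
        (∀ p q, P p → P q → p < q → v q < v p) →
        (∀ x, P (v.symm x) ↔ P (v'.symm x)) →
        (∀ y, y < p → P y → v y = v' y) → v' p ≤ v p := by
      intro v v' hv hvP hy
      have h1 : P (v.symm (v' p)) := by rw [hvP]; simpa using hp
      rcases lt_trichotomy (v.symm (v' p)) p with h2 | h2 | h2
      · have h3 := hy _ h2 h1
        simp only [Equiv.apply_symm_apply] at h3
        have h4 := v'.injective h3
        rw [← h4] at h2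
        exact absurd h2 (lt_irrefl _)
      · rw [Equiv.symm_apply_eq] at h2; exact h2.le
      · have := hv _ _ hp h1 h2
        simp at this
        exact this.le
    apply le_antisymm
    · exact key w' w h' (fun x => (hP x).symm) (fun y hy hPy => (ih y hy hPy).symm)
    · exact key w w' h hP (fun y hy hPy => ih y hy hPy)

lemma mem_B {n d i j : ℕ} (hij : i < j) {w : Equiv.Perm (Fin n)}
    {t : Fin d → Fin n × Fin n}
    (h : IJNormal i j w t) (x : Fin n) :
    (x ∈ topSet i w t ∧ x ∉ firstSet w j) ↔ ∃ k, (t k).2 = x := by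
  rw [mem_topSet hij h, mem_firstSet]
  obtain ⟨ho, hm, -, -, -, hd, hjd, ha, hb, -⟩ := h
  constructor
  · intro hx
    have hk : d - 1 - ((w.symm x : ℕ) - j) < d := by omega
    refine ⟨⟨_, hk⟩, ?_⟩
    apply w.symm.injective
    apply Fin.ext
    rw [hb]; simp only; omega
  · rintro ⟨k, rfl⟩
    rw [hb]; have := k.2; omega

lemma fst_le {n d i j : ℕ} (hij : i < j) {w w' : Equiv.Perm (Fin n)}
    {t t' : Fin d → Fin n × Fin n}
    (h : IJNormal i j w t) (h' : IJNormal i j w' t')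
    (hI : topSet i w t = topSet i w' t') (hJ : firstSet w j = firstSet w' j)
    (k : Fin d) (hb : (t k).2 = (t' k).2) (ih : ∀ m, m < k → (t m).1 = (t' m).1) :
    (t' k).1 ≤ (t k).1 := by
  by_contra! hlt
  set x := (t' k).1 with hx
  have hxw' : (w'.symm x : ℕ) = i - d + k := h'.2.2.2.2.2.2.2.1 k
  have hd : d ≤ i := h.2.2.2.2.2.1
  have hk := k.2
  have hxI : x ∉ topSet i w t := by
    rw [hI, mem_topSet hij h']; omega
  have hxJ : x ∈ firstSet w j := by
    rw [hJ, mem_firstSet]; omega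
  rw [mem_topSet hij h] at hxI
  rw [mem_firstSet] at hxJ
  have hxb : x < (t k).2 := by rw [hb]; exact h'.1.1 k
  apply no_between h k (w.symm x) ?_ (by omega) (by simpa using hlt) (by simpa using hxb)
  by_contra! hc
  have hm : (w.symm x : ℕ) - (i - d) < d := by omega
  have hxm : x = (t ⟨_, hm⟩).1 := by
    apply w.symm.injective
    apply Fin.ext
    rw [h.2.2.2.2.2.2.2.1]; simp only; omega
  rcases lt_or_eq_of_le hc with hc | hc
  · have h1 := ih ⟨_, hm⟩ (by rw [Fin.lt_def]; simp only; omega)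
    rw [← hxm] at h1
    have h2 := h'.2.2.2.2.2.2.2.1 ⟨_, hm⟩
    rw [← h1, hxw'] at h2
    simp only at h2
    omega
  · have : (⟨_, hm⟩ : Fin d) = k := by apply Fin.ext; simp only; omega
    rw [this] at hxm
    rw [← hxm] at hlt
    exact lt_irrefl _ hlt

lemma datum_inj {n d d' i j : ℕ} (hij : i < j) {w w' : Equiv.Perm (Fin n)}
    {t : Fin d → Fin n × Fin n} {t' : Fin d' → Fin n × Fin n}
    (h : IJNormal i j w t) (h' : IJNormal i j w' t')
    (hI : topSet i w t = topSet i w' t') (hJ : firstSet w j = firstSet w' j) :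
    (⟨d, w, t⟩ : Σ d : ℕ, Equiv.Perm (Fin n) × (Fin d → Fin n × Fin n)) = ⟨d', w', t'⟩ := by
  have hB : ∀ x, (∃ k, (t k).2 = x) ↔ ∃ k, (t' k).2 = x := by
    intro x
    rw [← mem_B hij h, ← mem_B hij h', hI, hJ]
  have hmono : StrictMono fun k => (t k).2 := fun k k' hk => h.2.2.2.2.1 k k' hk
  have hmono' : StrictMono fun k => (t' k).2 := fun k k' hk => h'.2.2.2.2.1 k k' hk
  have hrange : Set.range (fun k => (t k).2) = Set.range fun k => (t' k).2 := by
    ext x; exact hB x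
  have hdd : d = d' := by
    have h1 := Set.ncard_range_of_injective hmono.injective
    have h2 := Set.ncard_range_of_injective hmono'.injective
    rw [hrange, h2] at h1
    simpa using h1.symm
  subst hdd
  have hb : (fun k => (t k).2) = fun k => (t' k).2 := (hmono.range_inj hmono').1 hrange
  have ha : ∀ k, (t k).1 = (t' k).1 := by
    intro k
    induction k using WellFoundedLT.induction with
    | ind k ih =>
      apply le_antisymm
      · exact fst_le hij h' h hI.symm hJ.symm k (congrFun hb k).symm (fun m hm => (ih m hm).symm)
      · exact fst_le hij h h' hI hJ k (congrFun hb k) ih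
  have htt : t = t' := by
    funext k
    exact Prod.ext (ha k) (congrFun hb k)
  subst htt
  have hIx : ∀ x, _ := fun x => (mem_topSet hij h x).symm.trans
    ((Finset.ext_iff.1 hI x).trans (mem_topSet hij h' x))
  have hJx : ∀ x, _ := fun x => (mem_firstSet w j x).symm.trans
    ((Finset.ext_iff.1 hJ x).trans (mem_firstSet w' j x))
  obtain ⟨ho, -, -, -, -, hd, hjd, ha1, hb1, hX, hM, hR⟩ := h
  obtain ⟨-, -, -, -, -, -, -, ha1', hb1', hX', hM', hR'⟩ := h'
  have hA : ∀ v : Equiv.Perm (Fin n), (∀ k : Fin d, (v.symm (t k).1 : ℕ) = i - d + k) →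
      ∀ x, (i - d ≤ (v.symm x : ℕ) ∧ (v.symm x : ℕ) < i) ↔ ∃ k, x = (t k).1 := by
    intro v hv x
    constructor
    · intro hx
      have hm : (v.symm x : ℕ) - (i - d) < d := by omega
      refine ⟨⟨_, hm⟩, ?_⟩
      apply v.symm.injective
      apply Fin.ext
      rw [hv]; simp only; omega
    · rintro ⟨k, rfl⟩
      rw [hv]; have := k.2; omega
  have hAx : ∀ x, _ := fun x => (hA w ha1 x).trans (hA w' ha1' x).symm
  have hw : w = w' := by
    ext p
    congr 1
    by_cases c1 : (p : ℕ) < i - d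
    · refine agree w w' (fun p => (p : ℕ) < i - d) (fun p q _ hq hpq => hX p q hpq hq)
        (fun p q _ hq hpq => hX' p q hpq hq) ?_ p c1
      intro x
      have e1 := hIx x
      have e2 := hJx x
      omega
    by_cases c2 : (p : ℕ) < i
    · obtain ⟨k, hk⟩ := (hA w ha1 (w p)).1 (by simp; omega)
      have e1 := ha1 k
      have e2 := ha1' k
      rw [← hk] at e1 e2
      simp only [Equiv.symm_apply_apply] at e1
      rw [← Equiv.symm_apply_eq]
      rw [Equiv.symm_apply_eq, ← Equiv.symm_apply_eq (e := w')]
      apply Fin.ext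
      omega
    by_cases c3 : (p : ℕ) < j
    · refine agree w w' (fun p => i ≤ (p : ℕ) ∧ (p : ℕ) < j)
        (fun p q hp hq hpq => hM p q hp.1 hpq hq.2)
        (fun p q hp hq hpq => hM' p q hp.1 hpq hq.2) ?_ p (by omega)
      intro x
      have e1 := hIx x
      have e2 := hJx x
      have e3 := hAx x
      omega
    by_cases c4 : (p : ℕ) < j + d
    · have hm : d - 1 - ((p : ℕ) - j) < d := by omega
      have e1 := hb1 ⟨_, hm⟩
      have e2 := hb1' ⟨_, hm⟩
      have e3 : p = w.symm (t ⟨_, hm⟩).2 := by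
        apply Fin.ext; rw [e1]; simp only; omega
      have e4 : p = w'.symm (t ⟨_, hm⟩).2 := by
        apply Fin.ext; rw [e2]; simp only; omega
      rw [Equiv.eq_symm_apply] at e3 e4
      rw [e3, e4]
    · refine agree w w' (fun p => j + d ≤ (p : ℕ))
        (fun p q hp hq hpq => hR p q hp hpq)
        (fun p q hp hq hpq => hR' p q hp hpq) ?_ p (by omega)
      intro x
      have e1 := hIx x
      have e2 := hJx x
      omega
  rw [hw]

/-- The sum of the elements of a set. -/
def wt {n : ℕ} (S : Finset (Fin n)) : ℕ := ∑ x ∈ S, (x : ℕ)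

lemma wt_firstSet {n : ℕ} (w : Equiv.Perm (Fin n)) (i : ℕ) :
    wt (firstSet w i) = ∑ p ∈ Finset.univ.filter (fun p : Fin n => (p : ℕ) < i), (w p : ℕ) := by
  rw [wt, firstSet, Finset.sum_image (fun x _ y _ h => w.injective h)]

lemma wt_lt {n d i j : ℕ} (hij : i < j) {w : Equiv.Perm (Fin n)} {t : Fin d → Fin n × Fin n}
    (h : IJNormal i j w t) (K : Finset (Fin d)) (hK : K ≠ Finset.univ) :
    wt (firstSet (sL t K * w) i) < wt (topSet i w t) := by
  obtain ⟨ho, hm, -, -, -, hd, hjd, ha, hb, -⟩ := h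
  rw [topSet, wt_firstSet, wt_firstSet]
  apply Finset.sum_lt_sum
  · intro p hp
    simp only [Finset.mem_filter, Finset.mem_univ, true_and] at hp
    simp only [Equiv.Perm.mul_apply]
    by_cases h1 : ∃ k, w p = (t k).1
    · obtain ⟨k, hk⟩ := h1
      rw [hk, sL_fst ho, sL_fst ho]
      have := ho.1 k
      rw [Fin.lt_def] at this
      split_ifs <;> simp at * <;> omega
    · push Not at h1
      have h2 : ∀ k, w p ≠ (t k).2 := by
        intro k hk
        have := hb k
        rw [← hk] at this
        simp at this
        omega
      rw [sL_other ho _ _ h1 h2, sL_other ho _ _ h1 h2]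
  · obtain ⟨k, hk⟩ : ∃ k, k ∉ K := by
      by_contra! hc
      exact hK (Finset.eq_univ_iff_forall.2 hc)
    refine ⟨w.symm (t k).1, ?_, ?_⟩
    · simp only [Finset.mem_filter, Finset.mem_univ, true_and]
      rw [ha]; have := k.2; omega
    · simp only [Equiv.Perm.mul_apply, Equiv.apply_symm_apply]
      rw [sL_fst ho, sL_fst ho]
      simpa [hk] using ho.1 k

/-- The coordinate functional of `Λ^i` attached to `v`. -/
def coord (n i : ℕ) (hin : i ≤ n) (v : Equiv.Perm (Fin n)) : ⋀[ℂ]^i (Fin n → ℂ) →ₗ[ℂ] ℂ :=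
  exteriorPower.alternatingMapLinearEquiv
    ((Matrix.detRowAlternating (R := ℂ) (n := Fin i)).compLinearMap
      (LinearMap.funLeft ℂ ℂ fun l : Fin i => v (Fin.castLE hin l)))

lemma coord_eW (n i : ℕ) (hin : i ≤ n) (v w : Equiv.Perm (Fin n)) :
    coord n i hin v (eW n i w) = Matrix.det (Matrix.of fun k l : Fin i =>
      (Pi.single (w (Fin.castLE hin k)) (1 : ℂ) : Fin n → ℂ) (v (Fin.castLE hin l))) := by
  have : eW n i w = exteriorPower.ιMulti ℂ i
      (fun k : Fin i => (Pi.single (w (Fin.castLE hin k)) (1 : ℂ) : Fin n → ℂ)) := by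
    apply Subtype.ext
    rw [exteriorPower.ιMulti_apply_coe]
    simp only [eW]
    congr 1
    funext k
    rw [dif_pos (lt_of_lt_of_le k.2 hin)]
    rfl
  rw [this, coord, exteriorPower.alternatingMapLinearEquiv_apply_ιMulti]
  rfl

lemma coord_self (n i : ℕ) (hin : i ≤ n) (w : Equiv.Perm (Fin n)) :
    coord n i hin w (eW n i w) = 1 := by
  rw [coord_eW]
  rw [← Matrix.det_one (n := Fin i) (R := ℂ)]
  congr 1
  ext k l
  simp [Matrix.one_apply, Pi.single_apply, eq_comm]

lemma coord_ne (n i : ℕ) (hin : i ≤ n) (v w : Equiv.Perm (Fin n))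
    (h : coord n i hin v (eW n i w) ≠ 0) : firstSet v i = firstSet w i := by
  rw [coord_eW] at h
  ext x
  rw [mem_firstSet, mem_firstSet]
  constructor
  · intro hx
    by_contra hc
    apply h
    apply Matrix.det_eq_zero_of_column_eq_zero ⟨_, hx⟩
    intro k
    simp only [Matrix.of_apply, Pi.single_apply]
    rw [if_neg]
    intro hk
    have hk' : x = w (Fin.castLE hin k) := by
      rw [← hk]; symm; rw [← Equiv.eq_symm_apply]; rfl
    rw [hk'] at hc
    simp at hc
  · intro hx
    by_contra hc
    apply h
    apply Matrix.det_eq_zero_of_row_eq_zero ⟨_, hx⟩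
    intro l
    simp only [Matrix.of_apply, Pi.single_apply]
    rw [if_neg]
    intro hk
    have hk' : x = v (Fin.castLE hin l) := by
      rw [hk, ← Equiv.symm_apply_eq]; rfl
    rw [hk'] at hc
    simp at hc

lemma linInd_of_triangular {ι V : Type*} [AddCommMonoid V] [Module ℂ V] (e : ι → V)
    (φ : ι → V →ₗ[ℂ] ℂ) (r : ι → ℕ) (h1 : ∀ c, φ c (e c) ≠ 0)
    (h2 : ∀ c c', c ≠ c' → φ c (e c') ≠ 0 → r c < r c') : LinearIndependent ℂ e := by
  letI : AddCommGroup V := Module.addCommMonoidToAddCommGroup ℂ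
  rw [linearIndependent_iff']
  intro s g hg
  by_contra! hc
  obtain ⟨c₀, hc₀, hg₀⟩ := hc
  classical
  obtain ⟨c, hcm, hmax⟩ := Finset.exists_max_image (s.filter fun c => g c ≠ 0) r
    ⟨c₀, by simp [hc₀, hg₀]⟩
  simp only [Finset.mem_filter] at hcm hmax
  have h3 := congrArg (φ c) hg
  rw [map_sum, map_zero, Finset.sum_eq_single c] at h3
  · rw [map_smul, smul_eq_mul] at h3
    exact mul_ne_zero hcm.2 (h1 c) h3
  · intro b hb hbc
    rw [map_smul, smul_eq_mul]
    by_contra hne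
    have h4 := h2 c b hbc.symm (right_ne_zero_of_mul hne)
    have h5 := hmax b ⟨hb, left_ne_zero_of_mul hne⟩
    omega
  · intro h; exact absurd hcm.1 h

/-- The leading-coordinate functional of a datum. -/
def lead {n d : ℕ} (i j : ℕ) (hin : i ≤ n) (hjn : j ≤ n) (w : Equiv.Perm (Fin n))
    (t : Fin d → Fin n × Fin n) :
    (⋀[ℂ]^i (Fin n → ℂ)) ⊗[ℂ] (⋀[ℂ]^j (Fin n → ℂ)) →ₗ[ℂ] ℂ :=
  (TensorProduct.lid ℂ ℂ).toLinearMap ∘ₗ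
    TensorProduct.map (coord n i hin (sL t Finset.univ * w)) (coord n j hjn w)

lemma lead_eT {n d d' : ℕ} (q : ℂ) (i j : ℕ) (hin : i ≤ n) (hjn : j ≤ n)
    (w w' : Equiv.Perm (Fin n)) (t : Fin d → Fin n × Fin n) (t' : Fin d' → Fin n × Fin n) :
    lead i j hin hjn w t (eT q i j w' t') = ∑ L : Finset (Fin d'), q ^ L.card *
      (coord n i hin (sL t Finset.univ * w) (eW n i (sL t' Lᶜ * w')) *
        coord n j hjn w (eW n j (sL t' L * w'))) := by
  rw [eT, map_sum]
  refine Finset.sum_congr rfl fun L _ => ?_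
  rw [map_smul, smul_eq_mul]
  congr 1

/-- For `q` not a root of unity, the vectors `e_C^{ij}`, `C` ranging over
all `ij`-normal orthocell data in `Sₙ`, are linearly independent in `Λ^iℂⁿ ⊗ Λ^jℂⁿ`. -/
theorem linearIndependent_ijNormal (n i j : ℕ) (hi : 1 ≤ i) (hij : i < j) (hj : j ≤ n - 1)
    (q : ℂ) (hq : q ≠ 0) (hroot : ∀ k : ℕ, 0 < k → q ^ k ≠ 1) :
    LinearIndependent ℂ
      (fun C : {C : Σ d : ℕ, Equiv.Perm (Fin n) × (Fin d → Fin n × Fin n) //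
          IJNormal i j C.2.1 C.2.2} =>
        eT q i j C.1.2.1 C.1.2.2) := by
  have hjn : j ≤ n := by omega
  have hin : i ≤ n := by omega
  have hs0 : ∀ {d : ℕ} (t : Fin d → Fin n × Fin n), sL t ∅ = 1 := by
    intro d t; simp [sL]
  refine linInd_of_triangular
    (ι := {C : Σ d : ℕ, Equiv.Perm (Fin n) × (Fin d → Fin n × Fin n) //
      IJNormal i j C.2.1 C.2.2})
    (fun C => eT q i j C.1.2.1 C.1.2.2) (fun C => lead i j hin hjn C.1.2.1 C.1.2.2)
    (fun C => wt (topSet i C.1.2.1 C.1.2.2)) ?_ ?_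
  · rintro ⟨⟨d, w, t⟩, hC⟩
    simp only at hC ⊢
    rw [lead_eT, Finset.sum_eq_single ∅]
    · rw [Finset.compl_empty, hs0, one_mul, coord_self, coord_self]; simp
    · intro L _ hL
      by_contra hne
      have h1 := coord_ne _ _ _ _ _ (left_ne_zero_of_mul (right_ne_zero_of_mul hne))
      have h2 := wt_lt hij hC Lᶜ (by simpa using hL)
      rw [topSet, h1] at h2
      exact lt_irrefl _ h2
    · simp
  · rintro ⟨⟨d, w, t⟩, hC⟩ ⟨⟨d', w', t'⟩, hC'⟩ hne hnz
    simp only at hC hC' hnz ⊢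
    rw [lead_eT] at hnz
    obtain ⟨L, -, hL⟩ := Finset.exists_ne_zero_of_sum_ne_zero hnz
    have h1 := coord_ne _ _ _ _ _ (left_ne_zero_of_mul (right_ne_zero_of_mul hL))
    have h2 := coord_ne _ _ _ _ _ (right_ne_zero_of_mul (right_ne_zero_of_mul hL))
    by_cases hL0 : L = ∅
    · subst hL0
      rw [hs0, one_mul] at h2
      rw [Finset.compl_empty] at h1
      have h4 := datum_inj (w := w) (w' := w') (t := t) (t' := t') hij hC hC' h1 h2
      exact absurd (Subtype.ext h4) hne
    · have h3 := wt_lt hij hC' Lᶜ (by simpa using hL0)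
      rw [← h1] at h3
      exact h3

end QFlag
end
end
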